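/- arXiv:2112.05176 — 3 statements merged into one kernel-verified Lean document; each statement's English description precedes it below -/
import Mathlib

section
/- Let K, Q ∈ ℂ^{D×d} with K†K = 1_d and Q†Q = 1_d, let A ∈ ℂ^{d×d} be skew-Hermitian, and let R ∈ ℂ^{d×d} satisfy K†QR = 0. Define K_t = (K Q) exp(t S)(1_d; 0) with S = [[A, −R†],[R, 0]], and define K̈₂(t) := (K Q) exp(t S)(0; 1_d) R A. Then K_t† K̈₂(t) = 0 for all t ∈ ℝ. -/
open Matrix

lemma mul_exp_of_mul_eq_zero {n : Type*} [Fintype n] [DecidableEq n] {P X : Matrix n n ℂ}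
    (h : P * X = 0) : P * NormedSpace.exp X = P := by
  open scoped Norms.Operator in
  have key : SemiconjBy P X 0 := by rw [SemiconjBy, h, zero_mul]
  have h_exp := key.exp_right
  rwa [SemiconjBy, NormedSpace.exp_zero, one_mul] at h_exp

lemma conjTranspose_exp_mul_exp {n : Type*} [Fintype n] [DecidableEq n] {X : Matrix n n ℂ}
    (h : Xᴴ = -X) : (NormedSpace.exp X)ᴴ * NormedSpace.exp X = 1 := by
  rw [← Matrix.exp_conjTranspose, h, ← Matrix.exp_add_of_commute _ _ (Commute.refl X).neg_left,
    neg_add_cancel, NormedSpace.exp_zero]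

lemma conjTranspose_fromCols_mul_self {D d : ℕ} {K Q : Matrix (Fin D) (Fin d) ℂ}
    (hK : Kᴴ * K = 1) (hQ : Qᴴ * Q = 1) :
    (fromCols K Q)ᴴ * fromCols K Q =
      1 + fromBlocks 0 (Kᴴ * Q) 0 0 + (fromBlocks 0 (Kᴴ * Q) 0 0)ᴴ := by
  rw [conjTranspose_fromCols_eq_fromRows_conjTranspose, fromRows_mul_fromCols, hK, hQ,
    fromBlocks_conjTranspose, ← fromBlocks_one, fromBlocks_add, fromBlocks_add]
  simp

/-- For `K, Q` isometries, `A` skew-Hermitian and `R` with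
`KᴴQR = 0`, with `K_t = (K Q) exp(t S)(1; 0)` and
`K̈₂(t) = (K Q) exp(t S)(0; 1) R A` where `S = [[A, −Rᴴ],[R, 0]]`,
one has `K_tᴴ K̈₂(t) = 0` for all `t`. -/
theorem stiefel_geodesic_Kddot2 {D d : ℕ} (K Q : Matrix (Fin D) (Fin d) ℂ)
    (A R : Matrix (Fin d) (Fin d) ℂ)
    (hK : Kᴴ * K = 1) (hQ : Qᴴ * Q = 1) (hKQR : Kᴴ * Q * R = 0)
    (hA : Aᴴ = -A) :
    ∀ t : ℝ,
      (fromCols K Q * NormedSpace.exp (t • fromBlocks A (-Rᴴ) R 0) *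
          fromRows (1 : Matrix (Fin d) (Fin d) ℂ) 0)ᴴ *
        (fromCols K Q * NormedSpace.exp (t • fromBlocks A (-Rᴴ) R 0) *
          fromRows (0 : Matrix (Fin d) (Fin d) ℂ) (1 : Matrix (Fin d) (Fin d) ℂ) * R * A) = 0 := by
  intro t
  set X := t • fromBlocks A (-Rᴴ) R 0 with hX
  set P : Matrix (Fin d ⊕ Fin d) (Fin d ⊕ Fin d) ℂ := fromBlocks 0 (Kᴴ * Q) 0 0 with hP
  have skew : Xᴴ = -X := by
    rw [hX, conjTranspose_smul, fromBlocks_conjTranspose, hA, ← smul_neg, fromBlocks_neg]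
    simp
  have hPX : P * X = 0 := by
    rw [hX, Matrix.mul_smul, hP, fromBlocks_multiply]
    simp [hKQR]
  have hPE : P * NormedSpace.exp X = P := mul_exp_of_mul_eq_zero hPX
  have hEP : (NormedSpace.exp X)ᴴ * Pᴴ = Pᴴ := by rw [← conjTranspose_mul, hPE]
  have hEE := conjTranspose_exp_mul_exp skew
  generalize NormedSpace.exp X = E at *
  have gram : (fromCols K Q * E)ᴴ * (fromCols K Q * E) = 1 + Eᴴ * P + Pᴴ * E := by
    calc (fromCols K Q * E)ᴴ * (fromCols K Q * E)
        = Eᴴ * ((fromCols K Q)ᴴ * fromCols K Q) * E := by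
          simp only [conjTranspose_mul, Matrix.mul_assoc]
      _ = Eᴴ * E + Eᴴ * (P * E) + Eᴴ * Pᴴ * E := by
          rw [conjTranspose_fromCols_mul_self hK hQ]
          noncomm_ring
      _ = 1 + Eᴴ * P + Pᴴ * E := by rw [hEE, hPE, hEP]
  set e₁ : Matrix (Fin d ⊕ Fin d) (Fin d) ℂ := fromRows 1 0 with he₁
  set e₂ : Matrix (Fin d ⊕ Fin d) (Fin d) ℂ := fromRows 0 1 with he₂
  have orth : e₁ᴴ * e₂ = 0 := by
    simp [he₁, he₂, conjTranspose_fromRows_eq_fromCols_conjTranspose, fromCols_mul_fromRows]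
  have hPe₁ : e₁ᴴ * Pᴴ = 0 := by
    rw [← conjTranspose_mul]
    simp [he₁, hP, fromBlocks_mul_fromRows]
  have hPe₂ : P * (e₂ * R) = 0 := by
    simp [he₂, hP, fromBlocks_mul_fromRows, fromRows_mul, hKQR]
  calc (fromCols K Q * E * e₁)ᴴ * (fromCols K Q * E * e₂ * R * A)
      = e₁ᴴ * ((fromCols K Q * E)ᴴ * (fromCols K Q * E)) * (e₂ * R) * A := by
        rw [conjTranspose_mul (fromCols K Q * E) e₁]
        simp only [Matrix.mul_assoc]
    _ = (e₁ᴴ * e₂ * R + e₁ᴴ * Eᴴ * (P * (e₂ * R)) + e₁ᴴ * Pᴴ * E * (e₂ * R)) * A := by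
        rw [gram]
        simp only [Matrix.mul_add, Matrix.add_mul, Matrix.mul_one, Matrix.mul_assoc]
    _ = 0 := by simp [orth, hPe₁, hPe₂]
end

section
/- Let K, Q ∈ ℂ^{D×d} with K†K = 1_d and Q†Q = 1_d, let A ∈ ℂ^{d×d} be skew-Hermitian, and let R ∈ ℂ^{d×d} satisfy K†QR = 0. Define K̇₂(t) := (K Q) exp(t S)(0; 1_d) R with S = [[A, −R†],[R, 0]]. Then K̇₂(t)† K̇₂(t) = R†R for all t ∈ ℝ. -/
open Matrix

/-- An element that annihilates `a` from the left is fixed by right multiplication with `exp a`. -/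
theorem NormedSpace.mul_exp_eq_self_of_mul_eq_zero {B : Type*} [NormedRing B] [NormedAlgebra ℚ B]
    [CompleteSpace B] {x a : B} (h : x * a = 0) : x * NormedSpace.exp a = x := by
  have hs : SemiconjBy x a 0 := by simpa [SemiconjBy] using h
  simpa using hs.exp_right.eq

namespace Matrix

/-- A matrix that annihilates `S` from the left is fixed by right multiplication with `exp S`. -/
theorem mul_exp_eq_self_of_mul_eq_zero {m : Type*} [Fintype m] [DecidableEq m]
    {N S : Matrix m m ℂ} (h : N * S = 0) : N * NormedSpace.exp S = N :=
  open scoped Norms.Operator in NormedSpace.mul_exp_eq_self_of_mul_eq_zero h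

/-- The exponential of a skew-Hermitian matrix is unitary. -/
theorem conjTranspose_exp_mul_exp_of_skewHermitian {m : Type*} [Fintype m] [DecidableEq m]
    {S : Matrix m m ℂ} (h : Sᴴ = -S) : (NormedSpace.exp S)ᴴ * NormedSpace.exp S = 1 := by
  rw [← exp_conjTranspose, h, exp_neg]
  exact nonsing_inv_mul _ ((isUnit_iff_isUnit_det _).mp (isUnit_exp S))

end Matrix

/-- For `K, Q` isometries, `A` skew-Hermitian and `R` with
`KᴴQR = 0`, the matrix `K̇₂(t) = (K Q) exp(t S)(0; 1) R` with
`S = [[A, −Rᴴ],[R, 0]]` satisfies `K̇₂(t)ᴴ K̇₂(t) = RᴴR` for all `t`. -/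
theorem stiefel_geodesic_Kdot2 {D d : ℕ} (K Q : Matrix (Fin D) (Fin d) ℂ)
    (A R : Matrix (Fin d) (Fin d) ℂ)
    (hK : Kᴴ * K = 1) (hQ : Qᴴ * Q = 1) (hKQR : Kᴴ * Q * R = 0)
    (hA : Aᴴ = -A) :
    ∀ t : ℝ,
      (fromCols K Q * NormedSpace.exp (t • fromBlocks A (-Rᴴ) R 0) *
          fromRows (0 : Matrix (Fin d) (Fin d) ℂ) (1 : Matrix (Fin d) (Fin d) ℂ) * R)ᴴ *
        (fromCols K Q * NormedSpace.exp (t • fromBlocks A (-Rᴴ) R 0) *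
          fromRows (0 : Matrix (Fin d) (Fin d) ℂ) (1 : Matrix (Fin d) (Fin d) ℂ) * R) = Rᴴ * R := by
  intro t
  set S := t • fromBlocks A (-Rᴴ) R 0 with hS
  set N : Matrix (Fin d ⊕ Fin d) (Fin d ⊕ Fin d) ℂ := fromBlocks 0 (Kᴴ * Q) 0 0 with hN
  have hskew : Sᴴ = -S := by
    simp [hS, fromBlocks_conjTranspose, hA, fromBlocks_smul, fromBlocks_neg]
  have hNS : N * S = 0 := by
    simp [hS, hN, fromBlocks_multiply, hKQR]
  have hNW := mul_exp_eq_self_of_mul_eq_zero hNS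
  have hWW := conjTranspose_exp_mul_exp_of_skewHermitian hskew
  have hgram : (fromCols K Q)ᴴ * fromCols K Q = 1 + N + Nᴴ := by
    rw [conjTranspose_fromCols_eq_fromRows_conjTranspose, fromRows_mul_fromCols, hK, hQ, hN,
      fromBlocks_conjTranspose, ← fromBlocks_one, fromBlocks_add, fromBlocks_add]
    simp
  set W := NormedSpace.exp S
  set E := fromRows (0 : Matrix (Fin d) (Fin d) ℂ) (1 : Matrix (Fin d) (Fin d) ℂ) * R with hE
  have hNE : N * E = 0 := by
    rw [hE, hN, fromRows_mul, ← fromRows_fromCols_eq_fromBlocks, fromRows_mul,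
      fromCols_mul_fromRows, fromCols_mul_fromRows]
    simp [hKQR]
  have hEE : Eᴴ * E = Rᴴ * R := by
    rw [hE, fromRows_mul, conjTranspose_fromRows_eq_fromCols_conjTranspose,
      fromCols_mul_fromRows]
    simp
  have hNWE : N * (W * E) = 0 := by rw [← Matrix.mul_assoc, hNW, hNE]
  have hWEN : (W * E)ᴴ * Nᴴ = 0 := by rw [← conjTranspose_mul, hNWE, conjTranspose_zero]
  rw [Matrix.mul_assoc _ _ R, ← hE, Matrix.mul_assoc (fromCols K Q)]
  calc (fromCols K Q * (W * E))ᴴ * (fromCols K Q * (W * E))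
      = (W * E)ᴴ * ((fromCols K Q)ᴴ * fromCols K Q) * (W * E) := by
        simp only [conjTranspose_mul, Matrix.mul_assoc]
    _ = (W * E)ᴴ * (W * E) + (W * E)ᴴ * (N * (W * E)) + (W * E)ᴴ * Nᴴ * (W * E) := by
        rw [hgram]
        simp only [Matrix.mul_add, Matrix.add_mul, Matrix.mul_one, Matrix.mul_assoc]
    _ = Eᴴ * (Wᴴ * W) * E := by
        rw [hNWE, hWEN]
        simp only [conjTranspose_mul, Matrix.mul_zero, Matrix.zero_mul, add_zero,
          Matrix.mul_assoc]
    _ = Rᴴ * R := by rw [hWW, Matrix.mul_one, hEE]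
end

section
/- Let H = (1/√2)·[[1,1],[1,−1]] be the Hadamard gate and S = [[1,0],[0,i]] the phase gate, and let |0⟩, |1⟩ be the computational basis of ℂ². Define the single-qubit frame operator of random Pauli basis measurements as the linear map M on M₂(ℂ) given by M(X) = (1/3) Σ_{g ∈ {1, H, HS}} Σ_{b ∈ {0,1}} Tr(g†|b⟩⟨b|g · X) · g†|b⟩⟨b|g. Then for every X ∈ M₂(ℂ), M(3X − Tr(X)·1₂) = X; that is, M is invertible with inverse M⁻¹(X) = 3X − Tr(X)·1₂. -/
open Matrix

/-- The Hadamard gate `H = (1/√2)[[1,1],[1,−1]]`. -/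
noncomputable def hadamardGate : Matrix (Fin 2) (Fin 2) ℂ :=
  ((Real.sqrt 2 : ℂ))⁻¹ • !![1, 1; 1, -1]

/-- The phase gate `S = [[1,0],[0,i]]`. -/
def phaseGate : Matrix (Fin 2) (Fin 2) ℂ :=
  !![1, 0; 0, Complex.I]

/-- The three basis-change rotations `{1, H, HS}` of random Pauli basis
measurements. -/
noncomputable def pauliRotation : Fin 3 → Matrix (Fin 2) (Fin 2) ℂ
  | 0 => 1
  | 1 => hadamardGate
  | 2 => hadamardGate * phaseGate

/-- The single-qubit frame operator of random Pauli basis measurements: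
`M(X) = (1/3) Σ_{g ∈ {1,H,HS}} Σ_{b ∈ {0,1}} Tr(gᴴ|b⟩⟨b|g · X) · gᴴ|b⟩⟨b|g`. -/
noncomputable def shadowFrameOperator (X : Matrix (Fin 2) (Fin 2) ℂ) :
    Matrix (Fin 2) (Fin 2) ℂ :=
  (1 / 3 : ℂ) • ∑ g : Fin 3, ∑ b : Fin 2,
    Matrix.trace ((pauliRotation g)ᴴ * Matrix.single b b (1 : ℂ) *
        pauliRotation g * X) •
      ((pauliRotation g)ᴴ * Matrix.single b b (1 : ℂ) * pauliRotation g)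

theorem conjTranspose_hadamardGate_mul_mul (A : Matrix (Fin 2) (Fin 2) ℂ) :
    hadamardGateᴴ * A * hadamardGate =
      (1 / 2 : ℂ) • (!![1, 1; 1, -1] * A * !![1, 1; 1, -1]) := by
  have hsq : ((Real.sqrt 2 : ℂ))⁻¹ * ((Real.sqrt 2 : ℂ))⁻¹ = 1 / 2 := by
    rw [← mul_inv, ← Complex.ofReal_mul, Real.mul_self_sqrt zero_le_two]
    norm_num
  have hct : hadamardGateᴴ = hadamardGate := by
    ext i j
    fin_cases i <;> fin_cases j <;> simp [hadamardGate]
  rw [hct]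
  simp only [hadamardGate, Matrix.smul_mul, Matrix.mul_smul, smul_smul, hsq]

theorem single_zero_zero_fin_two :
    Matrix.single (0 : Fin 2) (0 : Fin 2) (1 : ℂ) = !![1, 0; 0, 0] := by
  ext i j
  fin_cases i <;> fin_cases j <;> simp

theorem single_one_one_fin_two :
    Matrix.single (1 : Fin 2) (1 : Fin 2) (1 : ℂ) = !![0, 0; 0, 1] := by
  ext i j
  fin_cases i <;> fin_cases j <;> simp

theorem conjTranspose_phaseGate_mul_mul (a b c d : ℂ) :
    phaseGateᴴ * !![a, b; c, d] * phaseGate =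
      !![a, b * Complex.I; -(Complex.I * c), d] := by
  ext i j
  fin_cases i <;> fin_cases j <;>
    simp [phaseGate, Matrix.mul_apply, Fin.sum_univ_two]
  linear_combination -d * Complex.I_mul_I

theorem conjTranspose_hadamardGate_mul_diag_one_zero_mul :
    hadamardGateᴴ * !![1, 0; 0, 0] * hadamardGate =
      !![1 / 2, 1 / 2; 1 / 2, 1 / 2] := by
  rw [conjTranspose_hadamardGate_mul_mul]
  simp

theorem conjTranspose_hadamardGate_mul_diag_zero_one_mul :
    hadamardGateᴴ * !![0, 0; 0, 1] * hadamardGate =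
      !![1 / 2, -1 / 2; -1 / 2, 1 / 2] := by
  rw [conjTranspose_hadamardGate_mul_mul]
  simp [neg_div]

theorem conjTranspose_mul_mul_mul (G P A : Matrix (Fin 2) (Fin 2) ℂ) :
    (G * P)ᴴ * A * (G * P) = Pᴴ * (Gᴴ * A * G) * P := by
  simp only [Matrix.conjTranspose_mul, Matrix.mul_assoc]

/-- The frame operator is the depolarizing map `X ↦ (X + Tr(X)·1) / 3`. -/
theorem shadowFrameOperator_eq (X : Matrix (Fin 2) (Fin 2) ℂ) :
    shadowFrameOperator X =
      (1 / 3 : ℂ) • (X + Matrix.trace X • (1 : Matrix (Fin 2) (Fin 2) ℂ)) := by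
  simp only [shadowFrameOperator, Fin.sum_univ_three, Fin.sum_univ_two, pauliRotation,
    conjTranspose_mul_mul_mul, conjTranspose_hadamardGate_mul_diag_one_zero_mul,
    conjTranspose_hadamardGate_mul_diag_zero_one_mul, conjTranspose_phaseGate_mul_mul,
    single_zero_zero_fin_two, single_one_one_fin_two, Matrix.conjTranspose_one,
    Matrix.one_mul, Matrix.mul_one]
  congr 1
  ext i j
  fin_cases i <;> fin_cases j <;>
    simp [Matrix.trace_fin_two, Matrix.vecMul, dotProduct, Fin.sum_univ_two] <;>
    ring_nf <;> simp only [Complex.I_sq] <;> ring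

/-- the frame operator `M` of single-qubit random Pauli basis
measurements satisfies `M(3X − Tr(X)·1) = X` for every `X ∈ M₂(ℂ)`; that is,
`M` is invertible with inverse `M⁻¹(X) = 3X − Tr(X)·1`. -/
theorem shadow_frame_operator_inverse (X : Matrix (Fin 2) (Fin 2) ℂ) :
    shadowFrameOperator ((3 : ℂ) • X - Matrix.trace X • (1 : Matrix (Fin 2) (Fin 2) ℂ)) =
      X := by
  have htr : Matrix.trace ((3 : ℂ) • X - Matrix.trace X • (1 : Matrix (Fin 2) (Fin 2) ℂ)) =
      Matrix.trace X := by
    simp only [Matrix.trace_sub, Matrix.trace_smul, Matrix.trace_one, Fintype.card_fin,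
      smul_eq_mul]
    push_cast
    ring
  rw [shadowFrameOperator_eq, htr, sub_add_cancel, smul_smul]
  norm_num
end
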